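/- Let G be an edge-colored complete graph K_n with minimum color degree δ^c(G) ≥ (n+1)/2. If G contains no monochromatic triangle, then every vertex of G is contained in properly colored cycles of every length from 3 to n. -/

import Mathlib

/-- An edge-colored graph (with total symmetric coloring `col`) contains a
monochromatic triangle. -/
def HasMonoTriangle {V : Type*} (col : V → V → ℕ) : Prop :=
  ∃ x y z : V, x ≠ y ∧ y ≠ z ∧ x ≠ z ∧ col x y = col y z ∧ col x y = col x z

/-- `c : ZMod ℓ → V` is a properly colored cycle of length `ℓ` in the
edge-colored complete graph with coloring `col`. -/
def IsPCCycle {V : Type*} {ℓ : ℕ} (col : V → V → ℕ) (c : ZMod ℓ → V) : Prop :=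
  Function.Injective c ∧
    ∀ i : ZMod ℓ, col (c i) (c (i + 1)) ≠ col (c (i + 1)) (c (i + 2))

/-- There is a properly colored cycle of length `ℓ` through `v`. -/
def PCThrough {V : Type*} (col : V → V → ℕ) (ℓ : ℕ) (v : V) : Prop :=
  ∃ c : ZMod ℓ → V, IsPCCycle col c ∧ ∃ i, c i = v

/-- `S` is a degenerate set of the edge-colored complete graph `col`. -/
def DegenSet {V : Type*} (col : V → V → ℕ) (S : Set V) : Prop :=
  S.Nonempty ∧ ∃ f : V → ℕ,
    (∀ u ∈ S, ∀ v ∈ S, u ≠ v → col u v = f u ∨ col u v = f v) ∧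
    (∀ u ∈ S, ∀ v, v ∉ S → col u v = f u)

section PeriodicCycles

variable {V : Type*} {col : V → V → ℕ}

/-- A properly colored cycle of length `ℓ`, presented as an `ℓ`-periodic sequence. -/
structure PeriodicPCCycle (col : V → V → ℕ) (ℓ : ℕ) (g : ℤ → V) : Prop where
  periodic : ∀ i : ℤ, g (i + ℓ) = g i
  ne_of_lt : ∀ i j : ℤ, i < j → j < i + ℓ → g i ≠ g j
  proper : ∀ i : ℤ, col (g i) (g (i + 1)) ≠ col (g (i + 1)) (g (i + 2))

/-- Some periodic properly colored cycle of length `ℓ` passes through `v`. -/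
def PeriodicPCThrough (col : V → V → ℕ) (ℓ : ℕ) (v : V) : Prop :=
  ∃ g, PeriodicPCCycle col ℓ g ∧ ∃ i, g i = v

theorem PeriodicPCThrough.pcThrough {ℓ : ℕ} {v : V} (h : PeriodicPCThrough col ℓ v)
    (hℓ : 0 < ℓ) : PCThrough col ℓ v := by
  obtain ⟨g, hg, i, rfl⟩ := h
  have hper : ∀ (k : ℕ) (i : ℤ), g (i + k * ℓ) = g i := by
    intro k
    induction k with
    | zero => simp
    | succ k ih =>
      intro i
      rw [← ih i, ← hg.periodic (i + k * ℓ)]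
      congr 1
      push_cast
      ring
  have hmod : ∀ i : ℤ, g (i % ℓ) = g i := by
    intro i
    have h1 := Int.emod_add_mul_ediv i ℓ
    rcases le_total 0 (i / ℓ) with h2 | h2
    · obtain ⟨k, hk⟩ := Int.eq_ofNat_of_zero_le h2
      rw [hk] at h1
      rw [← hper k (i % ℓ)]
      congr 1
      linarith
    · obtain ⟨k, hk⟩ := Int.eq_ofNat_of_zero_le (neg_nonneg.mpr h2)
      rw [← hper k i]
      congr 1
      have : i / ℓ = -k := by omega
      rw [this] at h1
      linarith
  have hcast : ∀ i j : ℤ, (i : ZMod ℓ) = j ↔ i % ℓ = j % ℓ := by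
    intro i j
    rw [ZMod.intCast_eq_intCast_iff]
    rfl
  let c : ZMod ℓ → V := fun z => g (Function.surjInv ZMod.intCast_surjective z)
  have hc : ∀ i : ℤ, c i = g i := by
    intro i
    have h1 := Function.surjInv_eq (ZMod.intCast_surjective (n := ℓ)) (i : ZMod ℓ)
    rw [hcast] at h1
    simp only [c]
    rw [← hmod, h1, hmod]
  refine ⟨c, ⟨?_, ?_⟩, (i : ZMod ℓ), hc i⟩
  · intro x y hxy
    obtain ⟨i, rfl⟩ := ZMod.intCast_surjective x
    obtain ⟨j, rfl⟩ := ZMod.intCast_surjective y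
    rw [hc, hc, ← hmod i, ← hmod j] at hxy
    rw [hcast]
    have hpos : (0 : ℤ) < ℓ := by exact_mod_cast hℓ
    have a1 := Int.emod_nonneg i hpos.ne'
    have a2 := Int.emod_nonneg j hpos.ne'
    have a3 := Int.emod_lt_of_pos i hpos
    have a4 := Int.emod_lt_of_pos j hpos
    rcases lt_trichotomy (i % ℓ) (j % ℓ) with h | h | h
    · exact absurd hxy (hg.ne_of_lt _ _ h (by omega))
    · exact h
    · exact absurd hxy.symm (hg.ne_of_lt _ _ h (by omega))
  · intro x
    obtain ⟨i, rfl⟩ := ZMod.intCast_surjective x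
    have h1 : ((i : ZMod ℓ) + 1) = ((i + 1 : ℤ) : ZMod ℓ) := by push_cast; rfl
    have h2 : ((i : ZMod ℓ) + 2) = ((i + 2 : ℤ) : ZMod ℓ) := by push_cast; rfl
    rw [h1, h2, hc, hc, hc]
    exact hg.proper i

theorem PeriodicPCCycle.exists_of_window {N : ℕ} (hN : 2 ≤ N) (u : ℤ → V)
    (hinj : ∀ i j : ℤ, 0 ≤ i → i < j → j < (N : ℤ) → u i ≠ u j)
    (hproper : ∀ i : ℤ, 0 ≤ i → i + 2 < N → col (u i) (u (i + 1)) ≠ col (u (i + 1)) (u (i + 2)))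
    (hlast : col (u (N - 2)) (u (N - 1)) ≠ col (u (N - 1)) (u 0))
    (hfirst : col (u (N - 1)) (u 0) ≠ col (u 0) (u 1)) :
    ∃ g, PeriodicPCCycle col N g ∧ ∀ i : ℤ, 0 ≤ i → i < N → g i = u i := by
  have hpos : (0 : ℤ) < N := by omega
  have hN' : (2 : ℤ) ≤ N := by omega
  have hwin : ∀ i : ℤ, 0 ≤ i → i < N → i % N = i := fun i h1 h2 => Int.emod_eq_of_lt h1 h2
  have hsucc : ∀ i : ℤ, (i % N + 1 < N ∧ (i + 1) % N = i % N + 1) ∨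
      (i % N + 1 = N ∧ (i + 1) % N = 0) := by
    intro i
    have a1 := Int.emod_nonneg i hpos.ne'
    have a3 := Int.emod_lt_of_pos i hpos
    have h : (i + 1) % N = (i % N + 1) % N := by rw [Int.emod_add_emod]
    rcases lt_or_eq_of_le (show i % N + 1 ≤ N by omega) with h1 | h1
    · exact Or.inl ⟨h1, by rw [h, hwin _ (by omega) h1]⟩
    · exact Or.inr ⟨h1, by rw [h, h1, Int.emod_self]⟩
  refine ⟨fun i => u (i % N), ⟨?_, ?_, ?_⟩, ?_⟩
  · intro i
    simp
  · intro i j hij hj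
    have a1 := Int.emod_nonneg i hpos.ne'
    have a2 := Int.emod_nonneg j hpos.ne'
    have a3 := Int.emod_lt_of_pos i hpos
    have a4 := Int.emod_lt_of_pos j hpos
    rcases lt_trichotomy (i % N) (j % N) with h | h | h
    · exact hinj _ _ a1 h a4
    · have h0 : (j - i) % N = 0 := Int.emod_eq_emod_iff_emod_sub_eq_zero.mp h.symm
      rw [hwin _ (by omega) (by omega)] at h0
      omega
    · exact (hinj _ _ a2 h a3).symm
  · intro i
    have a1 := Int.emod_nonneg i hpos.ne'
    have h2 : i + 2 = i + 1 + 1 := by ring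
    simp only [h2]
    rcases hsucc i with ⟨b1, b2⟩ | ⟨b1, b2⟩ <;> rcases hsucc (i + 1) with ⟨c1, c2⟩ | ⟨c1, c2⟩ <;>
      rw [c2, b2]
    · have := hproper (i % N) a1 (by omega)
      rwa [show i % N + 2 = i % N + 1 + 1 by ring] at this
    · rw [show i % N = N - 2 by omega, show (N : ℤ) - 2 + 1 = N - 1 by ring]
      exact hlast
    · rw [show i % N = N - 1 by omega]
      exact hfirst
    · omega
  · intro i h1 h2
    simp only [hwin i h1 h2]

namespace PeriodicPCCycle

variable {ℓ : ℕ} {g : ℤ → V}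

theorem shift (h : PeriodicPCCycle col ℓ g) (s : ℤ) : PeriodicPCCycle col ℓ fun i => g (i + s) where
  periodic i := by rw [← h.periodic (i + s)]; congr 1; ring
  ne_of_lt i j h1 h2 := h.ne_of_lt _ _ (by omega) (by omega)
  proper i := by
    have := h.proper (i + s)
    rwa [show i + s + 1 = i + 1 + s by ring, show i + s + 2 = i + 2 + s by ring] at this

theorem reverse (hsym : ∀ u v, col u v = col v u) (h : PeriodicPCCycle col ℓ g) :
    PeriodicPCCycle col ℓ fun i => g (-i) where
  periodic i := by rw [← h.periodic]; congr 1; ring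
  ne_of_lt i j h1 h2 := (h.ne_of_lt _ _ (by omega) (by omega)).symm
  proper i := by
    have := h.proper (-(i + 2))
    rw [show -(i + 2) + 1 = -(i + 1) by ring, show -(i + 2) + 2 = -i by ring] at this
    rw [hsym (g (-i)), hsym (g (-(i + 1))) (g (-(i + 2)))]
    exact this.symm

theorem proper_of_eq (h : PeriodicPCCycle col ℓ g) (i : ℤ) {j k : ℤ} (hj : j = i + 1)
    (hk : k = i + 2) : col (g i) (g j) ≠ col (g j) (g k) := by
  subst hj hk
  exact h.proper i

theorem eq_add (h : PeriodicPCCycle col ℓ g) (j i : ℤ) (hj : j = i + ℓ) : g j = g i := by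
  rw [hj, h.periodic]

theorem exists_rep (h : PeriodicPCCycle col ℓ g) (hℓ : 0 < ℓ) (s k : ℤ) :
    ∃ t, s ≤ t ∧ t < s + ℓ ∧ g t = g k ∧ ∀ m, g (t + m) = g (k + m) := by
  have hpos : (0 : ℤ) < ℓ := by exact_mod_cast hℓ
  have hper : ∀ (q : ℕ) (i : ℤ), g (i + q * ℓ) = g i := by
    intro q
    induction q with
    | zero => simp
    | succ q ih =>
      intro i
      rw [← ih i, ← h.periodic (i + q * ℓ)]
      congr 1
      push_cast
      ring
  have hsub : ∀ m, g (s + (k - s) % ℓ + m) = g (k + m) := by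
    intro m
    have h1 := Int.emod_add_mul_ediv (k - s) ℓ
    rcases le_total 0 ((k - s) / ℓ) with h2 | h2
    · obtain ⟨q, hq⟩ := Int.eq_ofNat_of_zero_le h2
      rw [hq] at h1
      rw [← hper q (s + (k - s) % ℓ + m)]
      congr 1
      linarith
    · obtain ⟨q, hq⟩ := Int.eq_ofNat_of_zero_le (neg_nonneg.mpr h2)
      rw [← hper q (k + m)]
      congr 1
      have : (k - s) / ℓ = -q := by omega
      rw [this] at h1
      linarith
  refine ⟨s + (k - s) % ℓ, ?_, ?_, by simpa using hsub 0, hsub⟩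
  · have := Int.emod_nonneg (k - s) hpos.ne'
    omega
  · have := Int.emod_lt_of_pos (k - s) hpos
    omega

theorem forall_of_succ (h : PeriodicPCCycle col ℓ g) (hℓ : 0 < ℓ) {P : ℤ → Prop}
    (hP : ∀ i j, g i = g j → (∀ m, g (i + m) = g (j + m)) → P i → P j)
    (hs : ∀ i, P i → P (i + 1)) {i : ℤ} (hi : P i) (j : ℤ) : P j := by
  obtain ⟨t, ht, -, hg, hg'⟩ := h.exists_rep hℓ i j
  refine hP t j hg hg' ?_
  obtain ⟨m, rfl⟩ := Int.le.dest ht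
  clear ht hg hg'
  induction m with
  | zero => simpa using hi
  | succ m ih =>
    have := hs _ ih
    rwa [show i + (m : ℤ) + 1 = i + ((m + 1 : ℕ) : ℤ) by push_cast; ring] at this

/-- A vertex outside the cycle can be inserted between two consecutive vertices. -/
theorem insert (h : PeriodicPCCycle col ℓ g) (hℓ : 3 ≤ ℓ) {w : V} (hw : ∀ i, g i ≠ w) (s : ℤ)
    (h1 : col (g (s - 1)) (g s) ≠ col (g s) w) (h2 : col (g s) w ≠ col w (g (s + 1)))
    (h3 : col w (g (s + 1)) ≠ col (g (s + 1)) (g (s + 2))) (k : ℤ) :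
    PeriodicPCThrough col (ℓ + 1) (g k) := by
  obtain ⟨u, hu⟩ : ∃ u : ℤ → V, u = fun t : ℤ => if t < ℓ then g (s + 1 + t) else w := ⟨_, rfl⟩
  have hu1 : ∀ t : ℤ, t < ℓ → u t = g (s + 1 + t) := fun t ht => by simp [hu, ht]
  have hu2 : u ℓ = w := by simp [hu]
  refine (exists_of_window (col := col) (N := ℓ + 1) (by omega) u ?_ ?_ ?_ ?_).elim ?_
  rotate_right
  · rintro g' ⟨hg', hgu⟩
    obtain ⟨t, ht1, ht2, ht, -⟩ := h.exists_rep (by omega) (s + 1) k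
    refine ⟨g', hg', t - (s + 1), ?_⟩
    rw [hgu _ (by omega) (by push_cast; omega), hu1 _ (by omega), ← ht]
    congr 1
    ring
  · intro i j hi hij hj
    push_cast at hj
    rw [hu1 i (by omega)]
    rcases lt_or_eq_of_le (show j ≤ ℓ by omega) with hj' | rfl
    · rw [hu1 j hj']
      exact h.ne_of_lt _ _ (by omega) (by omega)
    · rw [hu2]
      exact hw _
  · intro i hi hj
    push_cast at hj
    rw [hu1 i (by omega), hu1 (i + 1) (by omega)]
    rcases lt_or_eq_of_le (show i + 2 ≤ ℓ by omega) with hj' | hj'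
    · rw [hu1 (i + 2) hj']
      exact h.proper_of_eq _ (by ring) (by ring)
    · rw [hj', hu2, h.eq_add (s + 1 + (i + 1)) s (by omega), h.eq_add (s + 1 + i) (s - 1) (by omega)]
      exact h1
  · push_cast
    rw [show (ℓ : ℤ) + 1 - 2 = ℓ - 1 by ring, show (ℓ : ℤ) + 1 - 1 = ℓ by ring, hu2, hu1 _ (by omega),
      hu1 0 (by omega), h.eq_add (s + 1 + (ℓ - 1)) s (by omega), add_zero]
    exact h2
  · push_cast
    rw [show (ℓ : ℤ) + 1 - 1 = ℓ by ring, hu2, hu1 0 (by omega), hu1 1 (by omega), add_zero,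
      show s + 1 + 1 = s + 2 by ring]
    exact h3

/-- One vertex of the cycle can be replaced by two vertices outside it. -/
theorem replace_one (h : PeriodicPCCycle col ℓ g) (hℓ : 3 ≤ ℓ) {x y : V} (hx : ∀ i, g i ≠ x)
    (hy : ∀ i, g i ≠ y) (hxy : x ≠ y) (s : ℤ)
    (h1 : col (g (s - 1)) (g s) ≠ col (g s) x) (h2 : col (g s) x ≠ col x y)
    (h3 : col x y ≠ col y (g (s + 2)))
    (h4 : col y (g (s + 2)) ≠ col (g (s + 2)) (g (s + 3))) {k : ℤ} (hk : g (s + 1) ≠ g k) :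
    PeriodicPCThrough col (ℓ + 1) (g k) := by
  obtain ⟨u, hu⟩ : ∃ u : ℤ → V, u = fun t : ℤ => if t < ℓ - 1 then g (s + 2 + t)
    else if t = ℓ - 1 then x else y := ⟨_, rfl⟩
  have hu1 : ∀ t : ℤ, t < ℓ - 1 → u t = g (s + 2 + t) := fun t ht => by simp [hu, ht]
  have hu2 : u (ℓ - 1) = x := by simp [hu]
  have hu3 : u ℓ = y := by
    rw [hu]
    beta_reduce
    rw [if_neg (by omega), if_neg (by omega)]
  refine (exists_of_window (col := col) (N := ℓ + 1) (by omega) u ?_ ?_ ?_ ?_).elim ?_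
  rotate_right
  · rintro g' ⟨hg', hgu⟩
    obtain ⟨t, ht1, ht2, ht, -⟩ := h.exists_rep (by omega) (s + 2) k
    have : t ≠ s + 1 + ℓ := by
      rintro rfl
      exact hk (by rw [← ht, h.periodic])
    refine ⟨g', hg', t - (s + 2), ?_⟩
    rw [hgu _ (by omega) (by push_cast; omega), hu1 _ (by omega), ← ht]
    congr 1
    ring
  · intro i j hi hij hj
    push_cast at hj
    rcases lt_or_eq_of_le (show j ≤ ℓ by omega) with hj' | rfl
    · rw [hu1 i (by omega)]
      rcases lt_or_eq_of_le (show j ≤ ℓ - 1 by omega) with hj' | rfl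
      · rw [hu1 j hj']
        exact h.ne_of_lt _ _ (by omega) (by omega)
      · rw [hu2]
        exact hx _
    · rw [hu3]
      rcases lt_or_eq_of_le (show i ≤ ℓ - 1 by omega) with hj' | rfl
      · rw [hu1 i hj']
        exact hy _
      · rw [hu2]
        exact hxy
  · intro i hi hj
    push_cast at hj
    rw [hu1 i (by omega)]
    rcases lt_or_eq_of_le (show i + 2 ≤ ℓ by omega) with hj' | hj'
    · rw [hu1 (i + 1) (by omega)]
      rcases lt_or_eq_of_le (show i + 2 ≤ ℓ - 1 by omega) with hj' | hj'
      · rw [hu1 (i + 2) hj']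
        exact h.proper_of_eq _ (by ring) (by ring)
      · rw [hj', hu2, h.eq_add (s + 2 + (i + 1)) s (by omega), h.eq_add (s + 2 + i) (s - 1) (by omega)]
        exact h1
    · rw [hj', hu3, show i + 1 = ℓ - 1 by omega, hu2, h.eq_add (s + 2 + i) s (by omega)]
      exact h2
  · push_cast
    rw [show (ℓ : ℤ) + 1 - 2 = ℓ - 1 by ring, show (ℓ : ℤ) + 1 - 1 = ℓ by ring, hu2, hu3,
      hu1 0 (by omega), add_zero]
    exact h3
  · push_cast
    rw [show (ℓ : ℤ) + 1 - 1 = ℓ by ring, hu3, hu1 0 (by omega), hu1 1 (by omega), add_zero,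
      show s + 2 + 1 = s + 3 by ring]
    exact h4

/-- Two consecutive vertices of the cycle can be replaced by three vertices. -/
theorem replace_two (h : PeriodicPCCycle col ℓ g) (hℓ : 3 ≤ ℓ) {x y z : V} (s : ℤ)
    (hx : ∀ i, s + 3 ≤ i → i < s + ℓ + 1 → g i ≠ x) (hy : ∀ i, s + 3 ≤ i → i < s + ℓ + 1 → g i ≠ y)
    (hz : ∀ i, s + 3 ≤ i → i < s + ℓ + 1 → g i ≠ z) (hxy : x ≠ y) (hxz : x ≠ z) (hyz : y ≠ z)
    (h1 : col (g s) x = col (g s) (g (s + 1))) (h2 : col (g s) (g (s + 1)) ≠ col x y)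
    (h3 : col x y ≠ col y z) (h4 : col y z ≠ col (g (s + 2)) (g (s + 3)))
    (h5 : col z (g (s + 3)) = col (g (s + 2)) (g (s + 3))) {k : ℤ} (hk1 : g (s + 1) ≠ g k)
    (hk2 : g (s + 2) ≠ g k) :
    PeriodicPCThrough col (ℓ + 1) (g k) := by
  obtain ⟨u, hu⟩ : ∃ u : ℤ → V, u = fun t : ℤ => if t < ℓ - 2 then g (s + 3 + t)
    else if t = ℓ - 2 then x else if t = ℓ - 1 then y else z := ⟨_, rfl⟩
  have hu1 : ∀ t : ℤ, t < ℓ - 2 → u t = g (s + 3 + t) := fun t ht => by simp [hu, ht]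
  have hu2 : u (ℓ - 2) = x := by simp [hu]
  have hu3 : u (ℓ - 1) = y := by simp [hu]
  have hu4 : u ℓ = z := by
    rw [hu]
    beta_reduce
    rw [if_neg (by omega), if_neg (by omega), if_neg (by omega)]
  refine (exists_of_window (col := col) (N := ℓ + 1) (by omega) u ?_ ?_ ?_ ?_).elim ?_
  rotate_right
  · rintro g' ⟨hg', hgu⟩
    obtain ⟨t, ht1, ht2, ht, -⟩ := h.exists_rep (by omega) (s + 3) k
    have : t ≠ s + 1 + ℓ := by
      rintro rfl
      exact hk1 (by rw [← ht, h.periodic])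
    have : t ≠ s + 2 + ℓ := by
      rintro rfl
      exact hk2 (by rw [← ht, h.periodic])
    refine ⟨g', hg', t - (s + 3), ?_⟩
    rw [hgu _ (by omega) (by push_cast; omega), hu1 _ (by omega), ← ht]
    congr 1
    ring
  · intro i j hi hij hj
    push_cast at hj
    rcases lt_or_ge i (ℓ - 2) with hi' | hi'
    · rw [hu1 i hi']
      obtain hj' | rfl | rfl | rfl : j < ℓ - 2 ∨ j = ℓ - 2 ∨ j = ℓ - 1 ∨ j = ℓ := by omega
      · rw [hu1 j hj']
        exact h.ne_of_lt _ _ (by omega) (by omega)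
      · rw [hu2]
        exact hx _ (by omega) (by omega)
      · rw [hu3]
        exact hy _ (by omega) (by omega)
      · rw [hu4]
        exact hz _ (by omega) (by omega)
    · obtain ⟨rfl, rfl⟩ | ⟨rfl, rfl⟩ | ⟨rfl, rfl⟩ :
          (i = ℓ - 2 ∧ j = ℓ - 1) ∨ (i = ℓ - 2 ∧ j = ℓ) ∨ (i = ℓ - 1 ∧ j = ℓ) := by omega
      · rwa [hu2, hu3]
      · rwa [hu2, hu4]
      · rwa [hu3, hu4]
  · intro i hi hj
    push_cast at hj
    obtain hi' | rfl | rfl | rfl : i + 2 < ℓ - 2 ∨ i = ℓ - 4 ∨ i = ℓ - 3 ∨ i = ℓ - 2 := by omega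
    · rw [hu1 i (by omega), hu1 (i + 1) (by omega), hu1 (i + 2) hi']
      exact h.proper_of_eq _ (by ring) (by ring)
    · rw [show (ℓ : ℤ) - 4 + 2 = ℓ - 2 by ring, hu2, hu1 _ (by omega), hu1 _ (by omega),
        h.eq_add (s + 3 + (ℓ - 4 + 1)) s (by omega), h.eq_add (s + 3 + (ℓ - 4)) (s - 1) (by omega), h1]
      exact h.proper_of_eq _ (by ring) (by ring)
    · rw [show (ℓ : ℤ) - 3 + 2 = ℓ - 1 by ring, show (ℓ : ℤ) - 3 + 1 = ℓ - 2 by ring, hu2, hu3,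
        hu1 _ (by omega), h.eq_add (s + 3 + (ℓ - 3)) s (by omega), h1]
      exact h2
    · rw [show (ℓ : ℤ) - 2 + 2 = ℓ by ring, show (ℓ : ℤ) - 2 + 1 = ℓ - 1 by ring, hu2, hu3, hu4]
      exact h3
  · push_cast
    rw [show (ℓ : ℤ) + 1 - 2 = ℓ - 1 by ring, show (ℓ : ℤ) + 1 - 1 = ℓ by ring, hu3, hu4,
      hu1 0 (by omega), add_zero, h5]
    exact h4
  · push_cast
    rw [show (ℓ : ℤ) + 1 - 1 = ℓ by ring, hu4, hu1 0 (by omega), add_zero, h5]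
    rcases eq_or_lt_of_le (show (3 : ℤ) ≤ ℓ by omega) with hl | hl
    · have hs : g (s + 3) = g s := h.eq_add _ _ (by omega)
      rw [show (1 : ℤ) = ℓ - 2 by omega, hu2, hs, h1]
      rw [← hs, ← h.eq_add (s + 4) (s + 1) (by omega)]
      exact h.proper_of_eq _ (by ring) (by ring)
    · rw [hu1 1 (by omega)]
      exact h.proper_of_eq _ (by ring) (by ring)

/-- Two arcs of the cycle, one of them reversed, are joined by a chord and a vertex outside. -/
theorem reverse_arc (h : PeriodicPCCycle col ℓ g) (hsym : ∀ u v, col u v = col v u)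
    {w : V} (hw : ∀ i, g i ≠ w) (hF : ∀ i, col w (g i) = col (g i) (g (i + 1)))
    {i a b : ℤ} {N : ℕ} (hN : N = b) (ha : 1 ≤ a) (hab : a + 2 ≤ b) {j : ℤ}
    (hj : i + a ≤ j) (hb : j + b - a ≤ i + ℓ + 1)
    (hi : col (g i) (g j) ≠ col (g i) (g (i + 1)))
    (hj' : col (g i) (g j) ≠ col (g j) (g (j + 1)))
    (hne : col (g (i + a - 1)) (g (i + a)) ≠ col (g (j + b - a - 2)) (g (j + b - a - 1))) :
    ∃ g', PeriodicPCCycle col N g' ∧ g' 0 = w ∧ (∀ t, 1 ≤ t → t ≤ a → g' t = g (i + a - t)) ∧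
      ∀ t, a + 1 ≤ t → t < b → g' t = g (j + t - a - 1) := by
  obtain ⟨u, hu⟩ : ∃ u : ℤ → V, u = fun t : ℤ => if t = 0 then w else if t ≤ a then g (i + a - t)
    else g (j + t - a - 1) := ⟨_, rfl⟩
  have hu0 : u 0 = w := by simp [hu]
  have hu1 : ∀ t, 1 ≤ t → t ≤ a → u t = g (i + a - t) := fun t h1 h2 => by
    simp [hu, h2, show t ≠ 0 by omega]
  have hu2 : ∀ t, a + 1 ≤ t → u t = g (j + t - a - 1) := fun t h1 => by
    simp [hu, show ¬ t ≤ a by omega, show t ≠ 0 by omega]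
  refine (exists_of_window (col := col) (N := N) (by omega) u ?_ ?_ ?_ ?_).elim ?_
  rotate_right
  · rintro g' ⟨hg', hgu⟩
    refine ⟨g', hg', ?_, ?_, ?_⟩
    · rw [hgu 0 le_rfl (by omega), hu0]
    · intro t h1 h2
      rw [hgu t (by omega) (by omega), hu1 t h1 h2]
    · intro t h1 h2
      rw [hgu t (by omega) (by omega), hu2 t h1]
  · intro s t hs hst ht
    rcases eq_or_lt_of_le hs with rfl | hs
    · rw [hu0]
      rcases le_or_gt t a with hta | hta
      · rw [hu1 t (by omega) hta]
        exact (hw _).symm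
      · rw [hu2 t (by omega)]
        exact (hw _).symm
    · rcases le_or_gt t a with hta | hta
      · rw [hu1 t (by omega) hta, hu1 s (by omega) (by omega)]
        exact (h.ne_of_lt _ _ (by omega) (by omega)).symm
      · rw [hu2 t (by omega)]
        rcases le_or_gt s a with hsa | hsa
        · rw [hu1 s (by omega) hsa]
          exact h.ne_of_lt _ _ (by omega) (by omega)
        · rw [hu2 s (by omega)]
          exact h.ne_of_lt _ _ (by omega) (by omega)
  · intro t ht htN
    obtain ⟨rfl, rfl⟩ | ⟨rfl, h2⟩ | ⟨h1, h2⟩ | ⟨h1, h2⟩ | rfl | h1 : (t = 0 ∧ a = 1) ∨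
        (t = 0 ∧ 2 ≤ a) ∨ (1 ≤ t ∧ t + 2 ≤ a) ∨ (1 ≤ t ∧ a = t + 1) ∨ a = t ∨ a + 1 ≤ t := by omega
    · rw [hu0, hu1 (0 + 1) (by omega) (by omega), hu2 (0 + 2) (by omega), hF,
        show i + 1 - (0 + 1) = i by ring, show j + (0 + 2) - 1 - 1 = j by ring]
      exact hi.symm
    · rw [hu0, hu1 (0 + 1) (by omega) (by omega), hu1 (0 + 2) (by omega) (by omega), hF,
        hsym _ (g (i + a - (0 + 2)))]
      exact (h.proper_of_eq (i + a - (0 + 2)) (by ring) (by ring)).symm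
    · rw [hu1 t h1 (by omega), hu1 (t + 2) (by omega) h2, hu1 (t + 1) (by omega) (by omega),
        hsym, hsym _ (g (i + a - (t + 2)))]
      exact (h.proper_of_eq (i + a - (t + 2)) (by ring) (by ring)).symm
    · rw [hu1 t h1 (by omega), hu2 (t + 2) (by omega), hu1 (t + 1) (by omega) (by omega), hsym,
        show i + a - (t + 1) = i by omega, show i + a - t = i + 1 by omega,
        show j + (t + 2) - a - 1 = j by omega]
      exact hi.symm
    · rw [hu1 a ha le_rfl, hu2 (a + 2) (by omega), hu2 (a + 1) (by omega),
        show i + a - a = i by ring, show j + (a + 1) - a - 1 = j by ring,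
        show j + (a + 2) - a - 1 = j + 1 by ring]
      exact hj'
    · rw [hu2 t h1, hu2 (t + 2) (by omega), hu2 (t + 1) (by omega)]
      exact h.proper_of_eq _ (by ring) (by ring)
  · rw [hu0, hu2 (N - 1) (by omega), hsym _ w, hF]
    rcases eq_or_lt_of_le hab with hab | hab
    · rw [hu1 (N - 2) (by omega) (by omega), show i + a - (N - 2) = i by omega,
        show j + (N - 1) - a - 1 = j by omega]
      exact hj'
    · rw [hu2 _ (by omega)]
      exact h.proper_of_eq _ (by ring) (by ring)
  · rw [hu0, hu2 (N - 1) (by omega), hsym _ w, hF, hu1 1 le_rfl ha, hF, hN,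
      show j + (b - 1) - a - 1 + 1 = j + b - a - 1 by ring,
      show j + (b - 1) - a - 1 = j + b - a - 2 by ring, show i + a - 1 + 1 = i + a by ring]
    exact hne.symm

/-- A vertex that cannot be inserted sees the cycle in one color, or sees every vertex in the color
of its outgoing edge, or sees every vertex in the color of its incoming edge. -/
theorem uniform_of_not_through (h : PeriodicPCCycle col ℓ g) (hsym : ∀ u v, col u v = col v u)
    (hmono : ¬ HasMonoTriangle col) (hℓ : 3 ≤ ℓ) {w : V} (hw : ∀ i, g i ≠ w) {k : ℤ}
    (hno : ¬ PeriodicPCThrough col (ℓ + 1) (g k)) :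
    (∀ i j, col w (g i) = col w (g j)) ∨ (∀ i, col w (g i) = col (g i) (g (i + 1))) ∨
      ∀ i, col w (g i) = col (g (i - 1)) (g i) := by
  have hjoin : ∀ i, col w (g i) ≠ col (g (i - 1)) (g i) →
      col w (g (i + 1)) ≠ col (g (i + 1)) (g (i + 1 + 1)) → col w (g i) = col w (g (i + 1)) := by
    intro i h1 h2
    by_contra h3
    refine hno (h.insert hℓ hw i ?_ ?_ ?_ k)
    · rw [hsym _ w]
      exact h1.symm
    · rwa [hsym _ w]
    · rwa [show i + 2 = i + 1 + 1 by ring]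
  have htri : ∀ i, col w (g i) = col w (g (i + 1)) → col w (g i) ≠ col (g i) (g (i + 1)) := by
    intro i h1 h2
    exact hmono ⟨w, g i, g (i + 1), (hw _).symm, h.ne_of_lt _ _ (by omega) (by omega), (hw _).symm,
      h2, h1⟩
  by_cases hall : (∀ i, col w (g i) ≠ col (g i) (g (i + 1))) ∧
      ∀ i, col w (g i) ≠ col (g (i - 1)) (g i)
  · left
    intro i j
    refine (h.forall_of_succ (P := fun j => col w (g i) = col w (g j)) (by omega) ?_ ?_ rfl j)
    · intro a b hab _ ha
      exact hab ▸ ha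
    · intro a ha
      exact ha.trans (hjoin a (hall.2 a) (hall.1 _))
  rw [not_and_or] at hall
  push Not at hall
  right
  rcases hall with ⟨i, hi⟩ | ⟨i, hi⟩
  · left
    refine h.forall_of_succ (by omega) ?_ ?_ hi
    · intro a b hab hab' ha
      rwa [hab, hab'] at ha
    · intro a ha
      by_contra hne
      refine htri a (hjoin a ?_ hne) ha
      rw [ha]
      exact (h.proper_of_eq _ (by ring) (by ring)).symm
  · right
    by_contra hex
    push Not at hex
    obtain ⟨j, hj⟩ := hex
    refine h.forall_of_succ (P := fun i => col w (g i) ≠ col (g (i - 1)) (g i))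
      (by omega) ?_ ?_ hj i hi
    · intro a b hab hab' ha
      have := hab' (-1)
      rw [← sub_eq_add_neg, ← sub_eq_add_neg] at this
      rwa [← hab, ← this]
    · intro a ha
      simp only [add_sub_cancel_right]
      intro hne
      have h1 := hjoin a ha (by rw [hne]; exact h.proper_of_eq _ (by ring) (by ring))
      exact htri a h1 (h1.trans hne)

/-- A chord whose color differs from the colors of the cycle edges leaving its two ends. -/
def _root_.IsBadChord (col : V → V → ℕ) (ℓ : ℕ) (g : ℤ → V) (i a : ℤ) : Prop :=
  2 ≤ a ∧ a + 2 ≤ ℓ ∧ col (g i) (g (i + a)) ≠ col (g i) (g (i + 1)) ∧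
    col (g i) (g (i + a)) ≠ col (g (i + a)) (g (i + a + 1))

theorem _root_.IsBadChord.symm (h : PeriodicPCCycle col ℓ g) (hsym : ∀ u v, col u v = col v u)
    {i a : ℤ} (hbad : IsBadChord col ℓ g i a) : IsBadChord col ℓ g (i + a) (ℓ - a) := by
  obtain ⟨h1, h2, h3, h4⟩ := hbad
  refine ⟨by omega, by omega, ?_, ?_⟩
  · rwa [h.eq_add (i + a + (ℓ - a)) i (by ring), hsym]
  · rwa [h.eq_add (i + a + (ℓ - a)) i (by ring), h.eq_add (i + a + (ℓ - a) + 1) (i + 1) (by ring),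
      hsym]

section Forward

variable {w : V}

theorem color_eq_of_isBadChord (h : PeriodicPCCycle col ℓ g) (hsym : ∀ u v, col u v = col v u)
    (hw : ∀ i, g i ≠ w) (hF : ∀ i, col w (g i) = col (g i) (g (i + 1)))
    (hno : ¬ PeriodicPCThrough col (ℓ + 1) (g 0)) {i a : ℤ} (hbad : IsBadChord col ℓ g i a) :
    col (g (i + a - 1)) (g (i + a)) = col (g (i - 1)) (g i) := by
  obtain ⟨h1, h2, h3, h4⟩ := hbad
  by_contra hne
  obtain ⟨g', hg', -, hg1, hg2⟩ := h.reverse_arc hsym hw hF (i := i) (j := i + a) (a := a)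
    (b := ℓ + 1) (N := ℓ + 1) (by push_cast; rfl) (by omega) (by omega) le_rfl (by omega) h3 h4
    (by rwa [h.eq_add (i + a + (ℓ + 1) - a - 2) (i - 1) (by ring),
          h.eq_add (i + a + (ℓ + 1) - a - 1) i (by ring)])
  obtain ⟨t, ht1, ht2, ht, -⟩ := h.exists_rep (by omega) i 0
  refine hno ⟨g', hg', ?_⟩
  rcases lt_or_ge t (i + a) with hta | hta
  · refine ⟨i + a - t, ?_⟩
    rw [hg1 _ (by omega) (by omega), ← ht]
    congr 1
    ring
  · refine ⟨t - i + 1, ?_⟩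
    rw [hg2 _ (by omega) (by omega), ← ht]
    congr 1
    ring

/-- Rerouting along a bad chord exchanges one vertex of the cycle for `w`. -/
theorem exists_exchange (h : PeriodicPCCycle col ℓ g) (hsym : ∀ u v, col u v = col v u)
    (hw : ∀ i, g i ≠ w) (hF : ∀ i, col w (g i) = col (g i) (g (i + 1)))
    (hno : ¬ PeriodicPCThrough col (ℓ + 1) (g 0)) {i a : ℤ} (hbad : IsBadChord col ℓ g i a)
    (h0 : g (i + a - 1) ≠ g 0) :
    ∃ g', PeriodicPCCycle col ℓ g' ∧ g' 0 = w ∧ g' 1 = g (i + a - 2) ∧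
      (∀ t, a ≤ t → t < ℓ → g' t = g (i + t)) ∧ (∃ k, g' k = g 0) ∧
      ∀ u, u ≠ w → (∀ j, g j = u → g j = g (i + a - 1)) → ∀ k, g' k ≠ u := by
  have heq := h.color_eq_of_isBadChord hsym hw hF hno hbad
  obtain ⟨h1, h2, h3, h4⟩ := hbad
  obtain ⟨g', hg', hg0, hg1, hg2⟩ := h.reverse_arc hsym hw hF (i := i) (j := i + a) (a := a - 1)
    (b := ℓ) (N := ℓ) rfl (by omega) (by omega) (by omega) (by omega) h3 h4 (by
      rw [h.eq_add (i + a + ℓ - (a - 1) - 2) (i - 1) (by ring),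
        h.eq_add (i + a + ℓ - (a - 1) - 1) i (by ring), ← heq,
        show i + (a - 1) = i + a - 1 by ring]
      exact h.proper_of_eq _ (by ring) (by ring))
  have hg3 : ∀ t, a ≤ t → t < ℓ → g' t = g (i + t) := by
    intro t ha ht
    rw [hg2 t (by omega) ht]
    congr 1
    ring
  refine ⟨g', hg', hg0, ?_, hg3, ?_, ?_⟩
  · rw [hg1 1 le_rfl (by omega)]
    congr 1
    ring
  · obtain ⟨t, ht1, ht2, ht, -⟩ := h.exists_rep (by omega) i 0
    have : t ≠ i + a - 1 := by
      rintro rfl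
      exact h0 ht
    rcases lt_or_ge t (i + a) with hta | hta
    · refine ⟨i + (a - 1) - t, ?_⟩
      rw [hg1 _ (by omega) (by omega), ← ht]
      congr 1
      ring
    · refine ⟨t - i, ?_⟩
      rw [hg3 _ (by omega) (by omega), ← ht]
      congr 1
      ring
  · intro u huw hu k hk
    obtain ⟨t, ht1, ht2, ht, -⟩ := hg'.exists_rep (by omega) 0 k
    rw [← ht] at hk
    rcases eq_or_lt_of_le ht1 with rfl | ht1
    · exact huw (hk ▸ hg0)
    · rcases lt_or_ge t a with hta | hta
      · rw [hg1 t (by omega) (by omega)] at hk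
        exact h.ne_of_lt _ _ (by omega) (by omega) (hu _ hk)
      · rw [hg3 t hta (by omega)] at hk
        exact h.ne_of_lt _ _ (by omega) (by omega) (hu _ hk).symm

theorem color_mem_pair_of_isBadChord (h : PeriodicPCCycle col ℓ g)
    (hsym : ∀ u v, col u v = col v u) (hmono : ¬ HasMonoTriangle col) (hℓ : 3 ≤ ℓ)
    (hw : ∀ i, g i ≠ w) (hF : ∀ i, col w (g i) = col (g i) (g (i + 1)))
    (hno : ¬ PeriodicPCThrough col (ℓ + 1) (g 0)) {i a : ℤ} (hbad : IsBadChord col ℓ g i a)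
    (h0 : g (i + a - 1) ≠ g 0) {t : ℤ} (ht1 : i + a - 2 ≤ t) (ht2 : t ≤ i + ℓ - 1) :
    col (g t) (g (t + 1)) = col (g (i + a - 1)) (g (i + a)) ∨
      col (g t) (g (t + 1)) = col (g (i + a - 2)) (g (i + a - 1)) := by
  obtain rfl | rfl | rfl | ht : t = i + a - 2 ∨ t = i + a - 1 ∨ t = i + ℓ - 1 ∨
      (i + a ≤ t ∧ t ≤ i + ℓ - 2) := by omega
  · right
    congr 2
    ring
  · left
    congr 2
    ring
  · left
    rw [h.color_eq_of_isBadChord hsym hw hF hno hbad, h.eq_add (i + ℓ - 1) (i - 1) (by ring),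
      h.eq_add (i + ℓ - 1 + 1) i (by ring)]
  obtain ⟨g', hg', hg0, hg1, hg2, ⟨k, hk⟩, hout⟩ := h.exists_exchange hsym hw hF hno hbad h0
  obtain ⟨h1, h2, h3, h4⟩ := hbad
  have hu := hout (g (i + a - 1)) (hw _) fun j hj => hj
  have hpne : col (g (i + a - 2)) (g (i + a - 1)) ≠ col (g (i + a - 1)) (g (i + a)) :=
    h.proper_of_eq _ (by ring) (by ring)
  have huw : col (g (i + a - 1)) w = col (g (i + a - 1)) (g (i + a)) := by
    rw [hsym, hF, show i + a - 1 + 1 = i + a by ring]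
  have hwu : col w (g (i + a - 2)) = col (g (i + a - 2)) (g (i + a - 1)) := by
    rw [hF, show i + a - 2 + 1 = i + a - 1 by ring]
  rcases hg'.uniform_of_not_through hsym hmono hℓ hu (k := k) (by rwa [hk]) with hM | hM | hM
  · have := hM 0 1
    rw [hg0, hg1, huw, hsym _ (g (i + a - 2))] at this
    exact absurd this.symm hpne
  · have := hM 0
    rw [hg0, zero_add, hg1, huw, hwu] at this
    exact absurd this.symm hpne
  · have hc := hM (t + 1 - i)
    rw [hg2 _ (by omega) (by omega), hg2 _ (by omega) (by omega),
      show i + (t + 1 - i) = t + 1 by ring, show i + (t + 1 - i - 1) = t by ring] at hc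
    by_cases hb : IsBadChord col ℓ g (i + a - 1) (t + 1 - (i + a - 1))
    · have := h.color_eq_of_isBadChord hsym hw hF hno hb
      rw [show i + a - 1 + (t + 1 - (i + a - 1)) - 1 = t by ring,
        show i + a - 1 + (t + 1 - (i + a - 1)) = t + 1 by ring,
        show i + a - 1 - 1 = i + a - 2 by ring] at this
      exact Or.inr this
    · have hne : col (g t) (g (t + 1)) ≠ col (g (t + 1)) (g (t + 1 + 1)) :=
        h.proper_of_eq _ (by ring) (by ring)
      rw [IsBadChord, show i + a - 1 + (t + 1 - (i + a - 1)) = t + 1 by ring,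
        show i + a - 1 + 1 = i + a by ring, hc] at hb
      left
      by_contra hcon
      exact hb ⟨by omega, by omega, hcon, hne⟩

/-- Chords that are not bad, and cycle edges, follow the orientation of the cycle. -/
theorem color_eq_or_of_not_isBadChord (h : PeriodicPCCycle col ℓ g)
    (hsym : ∀ u v, col u v = col v u) (hℓ : 3 ≤ ℓ) {i j : ℤ} (hij : g i ≠ g j)
    (hbad : ∀ k a, g k = g i → g (k + a) = g j → ¬ IsBadChord col ℓ g k a) :
    col (g i) (g j) = col (g i) (g (i + 1)) ∨ col (g i) (g j) = col (g j) (g (j + 1)) := by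
  obtain ⟨t, ht1, ht2, ht, ht'⟩ := h.exists_rep (by omega) i j
  rw [← ht, ← ht' 1]
  rw [← ht] at hij
  have : t ≠ i := by
    rintro rfl
    exact hij rfl
  obtain rfl | rfl | h1 : t = i + 1 ∨ t = i + ℓ - 1 ∨ (i + 2 ≤ t ∧ t + 2 ≤ i + ℓ) := by omega
  · exact Or.inl rfl
  · right
    rw [hsym, h.eq_add (i + ℓ - 1 + 1) i (by ring)]
  · have := hbad i (t - i) rfl (by rw [← ht]; congr 1; ring)
    rw [IsBadChord, show i + (t - i) = t by ring] at this
    by_contra hcon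
    rw [not_or] at hcon
    exact this ⟨by omega, by omega, hcon.1, hcon.2⟩

end Forward

end PeriodicPCCycle

section Counting

open Finset

/-- The number of distinct colors on the edges at `v`. -/
def colorDegree [Fintype V] [DecidableEq V] (col : V → V → ℕ) (v : V) : ℕ :=
  ((univ.filter fun u => u ≠ v).image (col v)).card

variable [DecidableEq V]

theorem two_mul_sum_card_filter_le (hsym : ∀ u v, col u v = col v u) (S : Finset V) (f : V → ℕ)
    (hf : ∀ u ∈ S, ∀ w ∈ S, u ≠ w → col u w = f u ∨ col u w = f w) :
    2 * ∑ u ∈ S, #{w ∈ S | w ≠ u ∧ col u w ≠ f u} ≤ #S * (#S - 1) := by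
  have h1 : ∑ u ∈ S, #{w ∈ S | w ≠ u ∧ col u w ≠ f u} =
      ∑ u ∈ S, ∑ w ∈ S, if w ≠ u ∧ col u w ≠ f u then 1 else 0 := by
    simp only [card_filter]
  have h2 : #S * (#S - 1) = ∑ u ∈ S, ∑ w ∈ S, if w ≠ u then 1 else 0 := by
    rw [← smul_eq_mul, ← sum_const]
    refine sum_congr rfl fun u hu => ?_
    rw [← card_filter, ← card_erase_of_mem hu, filter_ne']
  rw [h1, h2, two_mul]
  nth_rw 2 [sum_comm]
  rw [← sum_add_distrib]
  refine sum_le_sum fun u hu => ?_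
  rw [← sum_add_distrib]
  refine sum_le_sum fun w hw => ?_
  by_cases huw : w = u
  · simp [huw]
  · have := hf u hu w hw (Ne.symm huw)
    rw [hsym w u]
    split_ifs <;> simp_all

theorem card_mul_le [Fintype V] (hsym : ∀ u v, col u v = col v u) {m : ℕ}
    (hdeg : ∀ u, m ≤ 2 * colorDegree col u) (S : Finset V) (f : V → ℕ)
    (hf : ∀ u ∈ S, ∀ w ∈ S, u ≠ w → col u w = f u ∨ col u w = f w) (X : V → Finset ℕ)
    (hX : ∀ u ∈ S, ∀ z, z ≠ u → col u z ∈ X u ∨ (z ∈ S ∧ col u z ≠ f u)) :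
    #S * m ≤ 2 * ∑ u ∈ S, #(X u) + #S * (#S - 1) := by
  have h1 : ∀ u ∈ S, colorDegree col u ≤ #(X u) + #{w ∈ S | w ≠ u ∧ col u w ≠ f u} := by
    intro u hu
    refine (card_le_card (t := X u ∪ image (col u) {w ∈ S | w ≠ u ∧ col u w ≠ f u}) ?_).trans
      ((card_union_le _ _).trans (Nat.add_le_add_left card_image_le _))
    intro c hc
    obtain ⟨z, hz, rfl⟩ := mem_image.1 hc
    rw [mem_filter] at hz
    rw [mem_union]
    rcases hX u hu z hz.2 with h | h
    · exact Or.inl h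
    · exact Or.inr (mem_image_of_mem _ (mem_filter.2 ⟨h.1, hz.2, h.2⟩))
  calc #S * m = ∑ u ∈ S, m := by simp
    _ ≤ ∑ u ∈ S, 2 * (#(X u) + #{w ∈ S | w ≠ u ∧ col u w ≠ f u}) :=
        sum_le_sum fun u hu => (hdeg u).trans (Nat.mul_le_mul_left 2 (h1 u hu))
    _ = 2 * ∑ u ∈ S, #(X u) + 2 * ∑ u ∈ S, #{w ∈ S | w ≠ u ∧ col u w ≠ f u} := by
        rw [← mul_sum, sum_add_distrib, mul_add]
    _ ≤ _ := Nat.add_le_add_left (two_mul_sum_card_filter_le hsym S f hf) _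

theorem PeriodicPCCycle.exists_finset_range {ℓ : ℕ} {g : ℤ → V} (h : PeriodicPCCycle col ℓ g)
    (hℓ : 0 < ℓ) : ∃ R : Finset V, #R = ℓ ∧ ∀ u, u ∈ R ↔ ∃ i, g i = u := by
  refine ⟨(Ico (0 : ℤ) ℓ).image g, ?_, ?_⟩
  · rw [card_image_of_injOn, Int.card_Ico]
    · simp
    · intro i hi j hj hij
      simp only [coe_Ico, Set.mem_Ico] at hi hj
      rcases lt_trichotomy i j with hlt | heq | hlt
      · exact absurd hij (h.ne_of_lt _ _ hlt (by omega))
      · exact heq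
      · exact absurd hij.symm (h.ne_of_lt _ _ hlt (by omega))
  · intro u
    simp only [mem_image, mem_Ico]
    constructor
    · rintro ⟨i, -, hi⟩
      exact ⟨i, hi⟩
    · rintro ⟨i, rfl⟩
      obtain ⟨t, h1, h2, ht, -⟩ := h.exists_rep hℓ 0 i
      exact ⟨t, ⟨h1, by omega⟩, ht⟩

variable [Fintype V]

/-- Under the color degree condition only the whole vertex set is degenerate. -/
theorem DegenSet.eq_univ (hsym : ∀ u v, col u v = col v u)
    (hdeg : ∀ u, Fintype.card V + 1 ≤ 2 * colorDegree col u) {S : Set V} (hS : DegenSet col S) :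
    S = Set.univ := by
  classical
  obtain ⟨⟨v, hv⟩, f, hf, hf'⟩ := hS
  have h := card_mul_le hsym hdeg S.toFinset f (by simpa using hf) (fun u => {f u}) (by
    intro u hu z hz
    simp only [mem_singleton, Set.mem_toFinset] at hu ⊢
    by_cases hzS : z ∈ S
    · tauto
    · exact Or.inl (hf' u hu z hzS))
  have hpos : 0 < #S.toFinset := card_pos.2 ⟨v, by simpa using hv⟩
  have hle : Fintype.card V ≤ #S.toFinset := by
    obtain ⟨s, hs⟩ := Nat.exists_eq_succ_of_ne_zero hpos.ne'
    simp only [card_singleton, sum_const, smul_eq_mul, mul_one] at h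
    rw [hs] at h ⊢
    simp only [Nat.succ_eq_add_one, Nat.add_sub_cancel] at h ⊢
    nlinarith
  rw [← Set.toFinset_eq_univ]
  exact (card_eq_iff_eq_univ _).1 (le_antisymm (card_le_univ _) hle)

theorem card_le_three_of_mem_pair (hdeg : ∀ u, Fintype.card V + 1 ≤ 2 * colorDegree col u)
    {w : V} {c d : ℕ} (hw : ∀ z, z ≠ w → col w z = c ∨ col w z = d) : Fintype.card V ≤ 3 := by
  have h : colorDegree col w ≤ #({c, d} : Finset ℕ) := by
    refine card_le_card fun x hx => ?_
    obtain ⟨z, hz, rfl⟩ := mem_image.1 hx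
    simpa using hw z (mem_filter.1 hz).2
  have := hdeg w
  have := card_le_two (a := c) (b := d)
  omega

/-- Every vertex lies in a rainbow triangle. -/
theorem exists_rainbow_triangle (hsym : ∀ u v, col u v = col v u)
    (hdeg : ∀ u, Fintype.card V + 1 ≤ 2 * colorDegree col u) (v : V) :
    ∃ u w, u ≠ v ∧ w ≠ v ∧ u ≠ w ∧ col v u ≠ col v w ∧ col u w ≠ col v u ∧ col u w ≠ col v w := by
  by_contra! hno
  obtain ⟨A, hA⟩ : ∃ A : Finset V, A = univ.erase v := ⟨_, rfl⟩
  obtain ⟨T, hT⟩ : ∃ T : Finset V, T = {u ∈ A | ∀ w ∈ A, col v w = col v u → w = u} := ⟨_, rfl⟩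
  have hTA : T ⊆ A := hT ▸ filter_subset _ _
  have hcard : #A + 1 = Fintype.card V := by
    rw [hA, card_erase_add_one (mem_univ v), card_univ]
  have hB : #(A \ T) + #T = #A := card_sdiff_add_card_eq_card hTA
  have hp : 2 * #((A \ T).image (col v)) ≤ #(A \ T) := by
    refine mul_card_image_le_card (f := col v) _ _ fun c hc => ?_
    obtain ⟨u, hu, rfl⟩ := mem_image.1 hc
    have hu' := mem_sdiff.1 hu
    rw [hT, mem_filter, not_and] at hu'
    have := hu'.2 hu'.1
    push Not at this
    obtain ⟨w, hw, hwu, hne⟩ := this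
    refine one_lt_card.2 ⟨u, mem_filter.2 ⟨hu, rfl⟩, w, mem_filter.2 ⟨?_, hwu⟩, hne.symm⟩
    rw [mem_sdiff, hT, mem_filter, not_and]
    exact ⟨hw, fun _ hall => hne (hall u hu'.1 hwu.symm).symm⟩
  have hD : colorDegree col v ≤ #T + #((A \ T).image (col v)) := by
    refine le_trans (card_le_card (t := T.image (col v) ∪ (A \ T).image (col v)) ?_)
      ((card_union_le _ _).trans (Nat.add_le_add_right card_image_le _))
    rw [← image_union, union_sdiff_of_subset hTA, hA, filter_ne']
  have hdv := hdeg v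
  have hdist : ∀ u ∈ T, ∀ z ∈ A, z ≠ u → col u z = col v u ∨ col u z = col v z := by
    intro u hu z hz hzu
    have hu' := hTA hu
    rw [hT, mem_filter] at hu
    rw [hA, mem_erase] at hz hu'
    by_contra! hcon
    refine hcon.2 (hno u z hu'.1 hz.1 hzu.symm (fun hc => hzu (hu.2 z (by simp [hA, hz.1]) hc.symm))
      hcon.1)
  have h := card_mul_le hsym hdeg T (col v)
    (fun u hu w hw huw => hdist u hu w (hTA hw) huw.symm)
    (fun u => insert (col v u) ((A \ T).image (col v))) (by
    intro u hu z hz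
    rcases eq_or_ne z v with rfl | hzv
    · exact Or.inl (by rw [hsym]; exact mem_insert_self _ _)
    have hzA : z ∈ A := by simp [hA, hzv]
    by_cases hc : col u z = col v u
    · exact Or.inl (hc ▸ mem_insert_self _ _)
    by_cases hzT : z ∈ T
    · exact Or.inr ⟨hzT, hc⟩
    · left
      rw [(hdist u hu z hzA hz).resolve_left hc]
      exact mem_insert_of_mem (mem_image_of_mem _ (mem_sdiff.2 ⟨hzA, hzT⟩)))
  have h2 : ∑ u ∈ T, #(insert (col v u) ((A \ T).image (col v))) ≤
      #T * (#((A \ T).image (col v)) + 1) := by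
    rw [← smul_eq_mul]
    exact sum_le_card_nsmul _ _ _ fun u _ => card_insert_le _ _
  obtain ⟨t, ht⟩ : ∃ t, #T = t + 1 := Nat.exists_eq_succ_of_ne_zero (by omega)
  rw [ht] at h h2 hD hB
  simp only [Nat.add_sub_cancel] at h
  have h3 : (t + 1) * (Fintype.card V + 1) ≤
      (t + 1) * (2 * (#((A \ T).image (col v)) + 1) + t) := by linarith
  have := Nat.le_of_mul_le_mul_left h3 (Nat.succ_pos t)
  omega

theorem periodicPCThrough_three (hsym : ∀ u v, col u v = col v u)
    (hdeg : ∀ u, Fintype.card V + 1 ≤ 2 * colorDegree col u) (v : V) :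
    PeriodicPCThrough col 3 v := by
  obtain ⟨u, w, huv, hwv, huw, h1, h2, h3⟩ := exists_rainbow_triangle hsym hdeg v
  obtain ⟨c, hc⟩ : ∃ c : ℤ → V, c = fun t => if t = 0 then v else if t = 1 then u else w := ⟨_, rfl⟩
  have hc0 : c 0 = v := by simp [hc]
  have hc1 : c 1 = u := by simp [hc]
  have hc2 : c 2 = w := by simp [hc]
  obtain ⟨g, hg, hgc⟩ := PeriodicPCCycle.exists_of_window (col := col) (N := 3) (by omega) c (by
    intro i j hi hij hj
    obtain ⟨rfl, rfl⟩ | ⟨rfl, rfl⟩ | ⟨rfl, rfl⟩ :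
      (i = 0 ∧ j = 1) ∨ (i = 0 ∧ j = 2) ∨ (i = 1 ∧ j = 2) := by omega
    · rw [hc0, hc1]
      exact huv.symm
    · rw [hc0, hc2]
      exact hwv.symm
    · rwa [hc1, hc2]) (by
    intro i hi hi'
    obtain rfl : i = 0 := by omega
    norm_num [hc0, hc1, hc2]
    exact h2.symm) (by
    norm_num [hc0, hc1, hc2]
    rwa [hsym w v]) (by
    norm_num [hc0, hc1, hc2]
    rw [hsym w v]
    exact h1.symm)
  exact ⟨g, hg, 0, by rw [hgc 0 le_rfl (by norm_num), hc0]⟩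

end Counting

namespace PeriodicPCCycle

open Finset

variable {ℓ : ℕ} {g : ℤ → V}

theorem add_eq_add_of_eq (h : PeriodicPCCycle col ℓ g) (hℓ : 0 < ℓ) {a b : ℤ} (hab : g a = g b)
    (m : ℤ) : g (a + m) = g (b + m) := by
  obtain ⟨t, ht1, ht2, ht, ht'⟩ := h.exists_rep hℓ a b
  rcases eq_or_lt_of_le ht1 with rfl | hlt
  · exact ht' m
  · exact absurd (hab.trans ht.symm) (h.ne_of_lt _ _ hlt ht2)

/-- Two vertices outside the cycle that follow its orientation exclude bad chords. -/
theorem not_isBadChord_of_two (h : PeriodicPCCycle col ℓ g) (hsym : ∀ u v, col u v = col v u)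
    (hmono : ¬ HasMonoTriangle col) (hℓ : 3 ≤ ℓ) {w w' : V} (hw : ∀ i, g i ≠ w)
    (hF : ∀ i, col w (g i) = col (g i) (g (i + 1))) (hw' : ∀ i, g i ≠ w')
    (hF' : ∀ i, col w' (g i) = col (g i) (g (i + 1))) (hne : w ≠ w')
    (hno : ¬ PeriodicPCThrough col (ℓ + 1) (g 0)) (i a : ℤ) : ¬ IsBadChord col ℓ g i a := by
  have hy : ∀ m, col w w' ≠ col w' (g m) := fun m hm =>
    hmono ⟨w, w', g m, hne, (hw' m).symm, (hw m).symm, hm, by rw [hm, hF, hF']⟩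
  have key : ∀ i a, g (i + a - 1) ≠ g 0 → ¬ IsBadChord col ℓ g i a := by
    intro i a h0 hbad
    obtain ⟨g', hg', hg0, hg1, hg2, ⟨k, hk⟩, hout⟩ := h.exists_exchange hsym hw hF hno hbad h0
    obtain ⟨h1, h2, -, -⟩ := hbad
    refine hno ?_
    rw [← hk]
    refine hg'.insert hℓ (hout w' hne.symm fun j hj => absurd hj (hw' j)) 0 ?_ ?_ ?_ k
    · rw [hg0, ← hg'.eq_add (ℓ - 1) (0 - 1) (by ring), hg2 _ (by omega) (by omega), hsym, hF, ← hF']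
      exact (hy _).symm
    · rw [hg0, zero_add, hg1]
      exact hy _
    · rw [zero_add, zero_add, hg1, hF', ← hF, ← hg0, ← hg1]
      exact hg'.proper_of_eq _ (by ring) (by ring)
  by_cases h0 : g (i + a - 1) = g 0
  · intro hbad
    refine key _ _ ?_ (hbad.symm h hsym)
    obtain ⟨h1, h2, -, -⟩ := hbad
    rw [← h0]
    exact (h.ne_of_lt _ _ (by omega) (by omega)).symm
  · exact key i a h0

theorem degenSet_range (h : PeriodicPCCycle col ℓ g) (hsym : ∀ u v, col u v = col v u) (hℓ : 3 ≤ ℓ)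
    {w : V} (hw : ∀ i, g i ≠ w)
    (hF : ∀ w, (∀ i, g i ≠ w) → ∀ i, col w (g i) = col (g i) (g (i + 1)))
    (hbad : ∀ i a, ¬ IsBadChord col ℓ g i a) : DegenSet col (Set.range g) := by
  refine ⟨⟨g 0, 0, rfl⟩, col w, ?_, ?_⟩
  · rintro _ ⟨i, rfl⟩ _ ⟨j, rfl⟩ hij
    rw [hF w hw, hF w hw]
    exact h.color_eq_or_of_not_isBadChord hsym hℓ hij fun _ _ _ _ => hbad _ _
  · rintro _ ⟨i, rfl⟩ z hz
    rw [hsym, hF w hw, hF z fun j hj => hz ⟨j, hj⟩]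

theorem ne_of_forall_eq (h : PeriodicPCCycle col ℓ g) (hmono : ¬ HasMonoTriangle col) (hℓ : 3 ≤ ℓ)
    {w : V} (hw : ∀ i, g i ≠ w) (hM : ∀ i j, col w (g i) = col w (g j)) (i j : ℤ) :
    col w (g i) ≠ col (g j) (g (j + 1)) := fun hij =>
  hmono ⟨w, g j, g (j + 1), (hw _).symm, h.ne_of_lt _ _ (by omega) (by omega), (hw _).symm,
    by rw [hM j i, hij], hM _ _⟩

/-- The outer vertices that see the cycle in one color form a degenerate set. -/
theorem degenSet_uniform (h : PeriodicPCCycle col ℓ g) (hsym : ∀ u v, col u v = col v u)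
    (hmono : ¬ HasMonoTriangle col) (hℓ : 3 ≤ ℓ) (hno : ¬ PeriodicPCThrough col (ℓ + 1) (g 0))
    (hex : ∃ w, (∀ i, g i ≠ w) ∧ ∀ i j, col w (g i) = col w (g j)) :
    DegenSet col {w | (∀ i, g i ≠ w) ∧ ∀ i j, col w (g i) = col w (g j)} := by
  have h10 : g (0 + 1) ≠ g 0 := (h.ne_of_lt _ _ (by omega) (by omega)).symm
  have h20 : g (1 + 1) ≠ g 0 := (h.ne_of_lt _ _ (by omega) (by omega)).symm
  refine ⟨hex, fun w => col w (g 0), ?_, ?_⟩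
  · rintro w ⟨hw, hM⟩ w' ⟨hw', hM'⟩ hne
    by_contra! hcon
    have hn := h.ne_of_forall_eq hmono hℓ hw hM
    have hn' := h.ne_of_forall_eq hmono hℓ hw' hM'
    refine hno (h.replace_one hℓ hw hw' hne 0 ?_ ?_ ?_ ?_ h10)
    · rw [hsym _ w]
      exact (hn 0 (0 - 1)).symm
    · rw [hsym _ w]
      exact hcon.1.symm
    · rw [hM' _ 0]
      exact hcon.2
    · exact hn' (0 + 2) (0 + 2)
  · rintro w ⟨hw, hM⟩ w' hw'
    have hn := h.ne_of_forall_eq hmono hℓ hw hM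
    by_cases hout : ∀ i, g i ≠ w'
    swap
    · push Not at hout
      obtain ⟨i, rfl⟩ := hout
      exact hM _ _
    by_contra hy
    have hne : w ≠ w' := by
      rintro rfl
      exact hw' ⟨hw, hM⟩
    rcases h.uniform_of_not_through hsym hmono hℓ hout hno with hM' | hF | hB
    · exact hw' ⟨hout, hM'⟩
    · have key : ∀ s, g (s + 1) ≠ g 0 → col (g s) (g (s + 1)) = col w w' := by
        intro s hs
        by_contra hsy
        refine hno (h.replace_one hℓ hout hw hne.symm s ?_ ?_ ?_ ?_ hs)
        · rw [hsym _ w', hF]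
          exact h.proper_of_eq _ (by ring) (by ring)
        · rwa [hsym _ w', hF, hsym w']
        · rwa [hsym w', hM _ 0]
        · have := hn (s + 2) (s + 2)
          rwa [show s + 2 + 1 = s + 3 by ring] at this
      exact h.proper_of_eq 0 rfl rfl ((key 0 h10).trans (key 1 h20).symm)
    · have key : ∀ s, g (s + 1) ≠ g 0 → col w w' = col (g (s + 1)) (g (s + 2)) := by
        intro s hs
        by_contra hsy
        have hB2 : col w' (g (s + 2)) = col (g (s + 1)) (g (s + 2)) := by
          rw [hB, show s + 2 - 1 = s + 1 by ring]
        refine hno (h.replace_one hℓ hw hout hne s ?_ ?_ ?_ ?_ hs)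
        · rw [hsym _ w]
          have := (hn s (s - 1)).symm
          rwa [sub_add_cancel] at this
        · rw [hsym _ w, hM _ 0]
          exact Ne.symm hy
        · rwa [hB2]
        · rw [hB2]
          exact h.proper_of_eq _ (by ring) (by ring)
      exact h.proper_of_eq 1 rfl rfl ((key 0 h10).symm.trans (key 1 h20))

variable [Fintype V] [DecidableEq V]

/-- If only one vertex is missing from the cycle, all bad chords meet `g 1`. -/
theorem eq_or_eq_of_isBadChord (h : PeriodicPCCycle col ℓ g) (hsym : ∀ u v, col u v = col v u)
    (hmono : ¬ HasMonoTriangle col)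
    (hdeg : ∀ u, Fintype.card V + 1 ≤ 2 * colorDegree col u) (hℓ : 3 ≤ ℓ)
    (hlt : ℓ < Fintype.card V) {w : V} (hw : ∀ i, g i ≠ w)
    (hF : ∀ i, col w (g i) = col (g i) (g (i + 1))) (huniq : ∀ u, u ≠ w → ∃ i, g i = u)
    (hno : ¬ PeriodicPCThrough col (ℓ + 1) (g 0)) {i a : ℤ} (hbad : IsBadChord col ℓ g i a) :
    g (i + a) = g 1 ∨ g i = g 1 := by
  have hstep : ∀ b, g (b - 1) = g 0 → g b = g 1 := fun b hb => by
    simpa using h.add_eq_add_of_eq (by omega) hb 1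
  by_cases h0 : g (i + a - 1) = g 0
  · exact Or.inl (hstep _ h0)
  by_cases h0' : g (i - 1) = g 0
  · exact Or.inr (hstep _ h0')
  exfalso
  have h1 := fun t => h.color_mem_pair_of_isBadChord hsym hmono hℓ hw hF hno hbad h0 (t := t)
  have h2 := fun t => h.color_mem_pair_of_isBadChord hsym hmono hℓ hw hF hno (hbad.symm h hsym)
    (by rwa [h.eq_add (i + a + (ℓ - a) - 1) (i - 1) (by ring)]) (t := t)
  obtain ⟨ha1, ha2, -, -⟩ := hbad
  have h3 := h1 (i + ℓ - 1) (by omega) (by omega)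
  have h4 := h1 (i + ℓ - 2) (by omega) (by omega)
  have hall : ∀ t, col (g t) (g (t + 1)) = col (g (i + a - 1)) (g (i + a)) ∨
      col (g t) (g (t + 1)) = col (g (i + a - 2)) (g (i + a - 1)) := by
    intro t
    obtain ⟨t', ht1, ht2, ht, ht'⟩ := h.exists_rep (by omega) (i + a - 2) t
    rw [← ht, ← ht' 1]
    rcases le_or_gt t' (i + ℓ - 1) with hle | hgt
    · exact h1 t' ht1 hle
    · have := h2 t' (by omega) (by omega)
      rw [show i + a + (ℓ - a) - 1 = i + ℓ - 1 by ring, show i + a + (ℓ - a) = i + ℓ - 1 + 1 by ring,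
        show i + ℓ - 1 + 1 - 2 = i + ℓ - 2 by ring,
        show i + ℓ - 1 = i + ℓ - 2 + 1 by ring] at this
      rw [show i + ℓ - 1 = i + ℓ - 2 + 1 by ring] at h3
      rcases this with h | h <;> rw [h] <;> assumption
  have := card_le_three_of_mem_pair hdeg (w := w) fun z hz => by
    obtain ⟨t, rfl⟩ := huniq z hz
    rw [hF]
    exact hall t
  omega

/-- A cycle whose outer vertices all follow its orientation can be extended. -/
theorem extend_of_forward (h : PeriodicPCCycle col ℓ g) (hsym : ∀ u v, col u v = col v u)
    (hmono : ¬ HasMonoTriangle col)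
    (hdeg : ∀ u, Fintype.card V + 1 ≤ 2 * colorDegree col u) (hℓ : 3 ≤ ℓ)
    (hlt : ℓ < Fintype.card V)
    (hF : ∀ w, (∀ i, g i ≠ w) → ∀ i, col w (g i) = col (g i) (g (i + 1))) :
    PeriodicPCThrough col (ℓ + 1) (g 0) := by
  by_contra hno
  obtain ⟨R, hR, hmem⟩ := h.exists_finset_range (by omega)
  obtain ⟨w, hwR⟩ : ∃ w, w ∉ R := by
    by_contra! hall
    have : R = univ := eq_univ_of_forall hall
    rw [this, card_univ] at hR
    omega
  have hw : ∀ i, g i ≠ w := fun i hi => hwR ((hmem w).2 ⟨i, hi⟩)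
  by_cases huniq : ∀ u, u ≠ w → ∃ i, g i = u
  · have hbad := fun i a => h.eq_or_eq_of_isBadChord hsym hmono hdeg hℓ hlt hw (hF w hw) huniq hno
      (i := i) (a := a)
    have h01 : g 0 ≠ g 1 := h.ne_of_lt _ _ (by omega) (by omega)
    have hcount := card_mul_le hsym hdeg (R.erase (g 1)) (col w) (by
      intro u hu z hz huz
      rw [mem_erase, hmem] at hu hz
      obtain ⟨hu1, i, rfl⟩ := hu
      obtain ⟨hz1, j, rfl⟩ := hz
      rw [hF w hw, hF w hw]
      refine h.color_eq_or_of_not_isBadChord hsym hℓ huz fun k a hk hka hb => ?_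
      rcases hbad k a hb with h' | h'
      · exact hz1 (hka.symm.trans h')
      · exact hu1 (hk.symm.trans h'))
      (fun u => if u = g 0 then {col w u} else {col w u, col u (g 1)}) (by
      intro u hu z hz
      by_cases hcu : col u z = col w u
      · left
        split_ifs <;> simp [hcu]
      have hzw : z ≠ w := by
        rintro rfl
        exact hcu (hsym _ _)
      by_cases hz1 : z = g 1
      · left
        subst hz1
        have : u ≠ g 0 := by
          rintro rfl
          rw [hF w hw] at hcu
          simp at hcu
        simp [this]
      · right
        exact ⟨mem_erase.2 ⟨hz1, (hmem z).2 (huniq z hzw)⟩, hcu⟩)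
    have hS0 : g 0 ∈ R.erase (g 1) := mem_erase.2 ⟨h01, (hmem _).2 ⟨0, rfl⟩⟩
    have hS : #(R.erase (g 1)) = ℓ - 1 := by
      rw [card_erase_of_mem ((hmem _).2 ⟨1, rfl⟩), hR]
    have hsum : ∑ u ∈ R.erase (g 1),
        #(if u = g 0 then {col w u} else {col w u, col u (g 1)} : Finset ℕ) ≤ 1 + (ℓ - 2) * 2 := by
      rw [← add_sum_erase _ _ hS0, if_pos rfl, card_singleton]
      refine Nat.add_le_add_left ?_ _
      rw [show ℓ - 2 = #((R.erase (g 1)).erase (g 0)) by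
        rw [card_erase_of_mem hS0, hS]; omega, ← smul_eq_mul]
      refine sum_le_card_nsmul _ _ _ fun u _ => ?_
      split_ifs
      · simp
      · exact card_le_two
    obtain ⟨s, rfl⟩ : ∃ s, ℓ = s + 2 := ⟨ℓ - 2, by omega⟩
    rw [hS] at hcount
    simp only [show s + 2 - 1 = s + 1 by omega, show s + 2 - 2 = s by omega,
      Nat.add_sub_cancel] at hcount hsum
    have : (s + 1) * (s + 4) ≤ (s + 1) * (Fintype.card V + 1) :=
      Nat.mul_le_mul_left _ (by omega)
    nlinarith
  · push Not at huniq
    obtain ⟨w', hne, hw'⟩ := huniq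
    have hbad := h.not_isBadChord_of_two hsym hmono hℓ hw (hF w hw) hw' (hF w' hw') hne.symm hno
    have := (h.degenSet_range hsym hℓ hw hF hbad).eq_univ hsym hdeg
    obtain ⟨i, hi⟩ := this.symm ▸ Set.mem_univ w
    exact hw i hi

/-- Outer vertices following the two orientations of the cycle do not coexist. -/
theorem false_of_forward_of_backward (h : PeriodicPCCycle col ℓ g)
    (hsym : ∀ u v, col u v = col v u) (hmono : ¬ HasMonoTriangle col)
    (hdeg : ∀ u, Fintype.card V + 1 ≤ 2 * colorDegree col u) (hℓ : 3 ≤ ℓ)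
    (hlt : ℓ < Fintype.card V)
    (htype : ∀ w, (∀ i, g i ≠ w) → (∀ i, col w (g i) = col (g i) (g (i + 1))) ∨
      ∀ i, col w (g i) = col (g (i - 1)) (g i))
    (hno : ¬ PeriodicPCThrough col (ℓ + 1) (g 0)) {w w' : V} (hw : ∀ i, g i ≠ w)
    (hF : ∀ i, col w (g i) = col (g i) (g (i + 1))) (hw' : ∀ i, g i ≠ w')
    (hB : ∀ i, col w' (g i) = col (g (i - 1)) (g i)) : False := by
  have hne : ∀ z, (∀ i, col z (g i) = col (g (i - 1)) (g i)) → w ≠ z := by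
    rintro z hz rfl
    have := hz 0
    rw [hF] at this
    exact h.proper_of_eq (0 - 1) (by ring) (by ring) this.symm
  have hB1 : ∀ i, col w' (g (i + 1)) = col (g i) (g (i + 1)) := fun i => by
    rw [hB, add_sub_cancel_right]
  have hg0 : ∀ i : ℤ, 0 < i → i < ℓ → g i ≠ g 0 := fun i hi hi' =>
    (h.ne_of_lt _ _ hi (by omega)).symm
  have htwo : ∀ s : ℤ, 0 ≤ s → s + 3 ≤ ℓ → col (g s) (g (s + 1)) = col (g (s + 2)) (g (s + 3)) := by
    intro s hs hs'
    by_contra hcon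
    refine hno (h.replace_two (y := g (s + 1)) hℓ s (fun i _ _ => hw i)
      (fun i _ _ => (h.ne_of_lt _ _ (by omega) (by omega)).symm) (fun i _ _ => hw' i)
      (hw _).symm (hne w' hB) (hw' _) ?_ ?_ ?_ ?_ ?_ (hg0 _ (by omega) (by omega))
      (hg0 _ (by omega) (by omega)))
    · rw [hsym, hF]
    · rw [hF]
      exact h.proper_of_eq _ (by ring) (by ring)
    · rw [hF, hsym _ w', hB1]
      exact (h.proper_of_eq _ (by ring) (by ring)).symm
    · rwa [hsym _ w', hB1]
    · rw [hB, show s + 3 - 1 = s + 2 by ring]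
  have hℓ4 : 4 ≤ ℓ := by
    by_contra hl
    have h1 := htwo 0 le_rfl (by omega)
    rw [h.eq_add (0 + 3) 0 (by omega)] at h1
    refine h.proper_of_eq (0 + 2) (j := 0 + 3) (k := 0 + 4) (by ring) (by ring) ?_
    rw [h.eq_add (0 + 3) 0 (by omega), h.eq_add (0 + 4) (0 + 1) (by omega), h1]
  have hpair : ∀ t : ℕ, t < ℓ → col (g t) (g (t + 1)) = col (g 0) (g 1) ∨
      col (g t) (g (t + 1)) = col (g 1) (g 2) := by
    intro t
    induction t using Nat.strong_induction_on with
    | _ t ih =>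
      intro ht
      obtain rfl | rfl | ⟨s, rfl⟩ : t = 0 ∨ t = 1 ∨ ∃ s, t = s + 2 := by
        rcases t with _ | _ | s
        · exact Or.inl rfl
        · exact Or.inr (Or.inl rfl)
        · exact Or.inr (Or.inr ⟨s, rfl⟩)
      · left
        norm_num
      · right
        norm_num
      · have := htwo s (by omega) (by omega)
        push_cast
        rw [show (s : ℤ) + 2 + 1 = s + 3 by ring, ← this]
        exact ih s (by omega) (by omega)
  have hout : ∀ z, (∀ i, g i ≠ z) → (∀ i, col z (g i) = col (g (i - 1)) (g i)) →
      col w z = col (g 0) (g 1) ∨ col w z = col (g 1) (g 2) := by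
    intro z hz hzB
    by_contra! hcon
    have hz2 : col z (g (0 + 2)) = col (g 1) (g 2) := by
      rw [hzB]
      norm_num
    refine hno (h.replace_one hℓ hw hz (hne z hzB) 0 ?_ ?_ ?_ ?_
      (hg0 _ (by omega) (by omega)))
    · rw [hsym _ w, hF]
      exact h.proper_of_eq _ (by ring) (by ring)
    · rw [hsym _ w, hF]
      exact hcon.1.symm
    · rw [hz2]
      exact hcon.2
    · rw [hz2]
      exact h.proper_of_eq _ (by ring) (by ring)
  have huniq : ∀ z, (∀ i, g i ≠ z) → z ≠ w → ¬ ∀ i, col z (g i) = col (g i) (g (i + 1)) := by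
    intro z hz hzw hzF
    have htri : ∀ m, col z w ≠ col (g m) (g (m + 1)) := fun m hm =>
      hmono ⟨z, w, g m, hzw, (hw m).symm, (hz m).symm, by rw [hm, hF], by rw [hm, hzF]⟩
    have key : ∀ s : ℤ, 0 ≤ s → s ≤ 1 → col w w' = col (g (s + 2)) (g (s + 3)) := by
      intro s hs hs'
      by_contra hcon
      refine hno (h.replace_two hℓ s (fun i _ _ => hz i) (fun i _ _ => hw i) (fun i _ _ => hw' i)
        hzw (by
          rintro rfl
          have := hzF 0
          rw [hB] at this
          exact h.proper_of_eq (0 - 1) (by ring) (by ring) this) (hne w' hB) ?_ (htri s).symm ?_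
        hcon ?_ (hg0 _ (by omega) (by omega)) (hg0 _ (by omega) (by omega)))
      · rw [hsym, hzF]
      · rcases hout w' hw' hB with h' | h' <;> rw [h']
        · exact htri 0
        · exact htri 1
      · rw [hB, show s + 3 - 1 = s + 2 by ring]
    exact h.proper_of_eq (0 + 2) (by ring) (by ring)
      ((key 0 le_rfl (by norm_num)).symm.trans (key 1 (by norm_num) le_rfl))
  have := card_le_three_of_mem_pair hdeg (w := w) (c := col (g 0) (g 1)) (d := col (g 1) (g 2))
    fun z hzw => by
      by_cases hz : ∀ i, g i ≠ z
      · exact hout z hz ((htype z hz).resolve_left (huniq z hz hzw))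
      · push Not at hz
        obtain ⟨i, rfl⟩ := hz
        obtain ⟨t, ht1, ht2, ht, ht'⟩ := h.exists_rep (by omega) 0 i
        lift t to ℕ using ht1
        rw [hF, ← ht, ← ht' 1]
        exact hpair t (by omega)
  omega

theorem extend (h : PeriodicPCCycle col ℓ g) (hsym : ∀ u v, col u v = col v u)
    (hmono : ¬ HasMonoTriangle col)
    (hdeg : ∀ u, Fintype.card V + 1 ≤ 2 * colorDegree col u) (hℓ : 3 ≤ ℓ)
    (hlt : ℓ < Fintype.card V) : PeriodicPCThrough col (ℓ + 1) (g 0) := by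
  by_contra hno
  by_cases hex : ∃ w, (∀ i, g i ≠ w) ∧ ∀ i j, col w (g i) = col w (g j)
  · have := (h.degenSet_uniform hsym hmono hℓ hno hex).eq_univ hsym hdeg
    have h0 : g 0 ∈ (Set.univ : Set V) := Set.mem_univ _
    rw [← this] at h0
    exact h0.1 0 rfl
  have htype : ∀ w, (∀ i, g i ≠ w) → (∀ i, col w (g i) = col (g i) (g (i + 1))) ∨
      ∀ i, col w (g i) = col (g (i - 1)) (g i) := fun w hw =>
    (h.uniform_of_not_through hsym hmono hℓ hw hno).resolve_left fun hM => hex ⟨w, hw, hM⟩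
  by_cases hF : ∀ w, (∀ i, g i ≠ w) → ∀ i, col w (g i) = col (g i) (g (i + 1))
  · exact hno (h.extend_of_forward hsym hmono hdeg hℓ hlt hF)
  · rw [not_forall] at hF
    obtain ⟨w', hF⟩ := hF
    rw [Classical.not_imp] at hF
    obtain ⟨hw', hF'⟩ := hF
    have hB' := (htype w' hw').resolve_left hF'
    have hall : ∀ w, (∀ i, g i ≠ w) → ∀ i, col w (g i) = col (g (i - 1)) (g i) := fun w hw =>
      (htype w hw).resolve_left fun hF =>
        h.false_of_forward_of_backward hsym hmono hdeg hℓ hlt htype hno hw hF hw' hB'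
    refine hno ?_
    have := (h.reverse hsym).extend_of_forward hsym hmono hdeg hℓ hlt fun w hw i => by
      rw [hall w (fun j => by simpa using hw (-j)), hsym, show -i - 1 = -(i + 1) by ring]
    simpa using this

end PeriodicPCCycle

theorem periodicPCThrough_of_le [Fintype V] [DecidableEq V] (hsym : ∀ u v, col u v = col v u)
    (hmono : ¬ HasMonoTriangle col)
    (hdeg : ∀ u, Fintype.card V + 1 ≤ 2 * colorDegree col u) (v : V) {ℓ : ℕ} (hℓ : 3 ≤ ℓ)
    (hle : ℓ ≤ Fintype.card V) : PeriodicPCThrough col ℓ v := by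
  induction ℓ, hℓ using Nat.le_induction with
  | base => exact periodicPCThrough_three hsym hdeg v
  | succ ℓ hℓ ih =>
    obtain ⟨g, hg, i, rfl⟩ := ih (by omega)
    simpa using (hg.shift i).extend hsym hmono hdeg hℓ (by omega)

end PeriodicCycles

/-- Chen et al.: if an edge-colored $K_n$ has minimum color degree at least
$(n+1)/2$ and no monochromatic triangle, then every vertex lies on PC cycles
of all lengths from 3 to $n$. -/
theorem vertex_pancyclic_of_large_color_degree
    (n : ℕ) (col : Fin n → Fin n → ℕ)
    (hsym : ∀ u v, col u v = col v u)
    (hdeg : ∀ v : Fin n,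
      n + 1 ≤ 2 * ((Finset.univ.filter fun u => u ≠ v).image (col v)).card)
    (hmono : ¬ HasMonoTriangle col) :
    ∀ v : Fin n, ∀ ℓ : ℕ, 3 ≤ ℓ → ℓ ≤ n → PCThrough col ℓ v := by
  intro v ℓ hℓ hle
  exact (periodicPCThrough_of_le hsym hmono (by simpa [colorDegree] using hdeg) v hℓ
    (by simpa using hle)).pcThrough (by omega)
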